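/- arXiv:0902.2264 — 2 statements merged into one kernel-verified Lean document; each statement's English description precedes it below -/
import Mathlib

section
/- Let A be a residuated lattice and (L, λ) a reticulation of A. Then A is a strongly Stone residuated lattice if and only if L is a strongly Stone lattice. -/
/-- A residuated lattice: a bounded lattice with a commutative monoid operation `mul`
(with unit `⊤`) and a residuum `himp` satisfying residuation. -/
class ResiduatedLattice (A : Type*) extends Lattice A, BoundedOrder A where
  mul : A → A → A
  himp : A → A → A
  mul_comm : ∀ a b : A, mul a b = mul b a
  mul_assoc : ∀ a b c : A, mul (mul a b) c = mul a (mul b c)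
  mul_top : ∀ a : A, mul a ⊤ = a
  residuation : ∀ a b c : A, a ≤ himp b c ↔ mul a b ≤ c

namespace ResiduatedLattice

variable {A : Type*} [ResiduatedLattice A]

/-- Powers with respect to the monoid operation `mul`. -/
def rpow (a : A) : ℕ → A
  | 0 => ⊤
  | n + 1 => mul a (rpow a n)

end ResiduatedLattice

open ResiduatedLattice

/-- A filter of a residuated lattice: a nonempty subset closed under `mul` and upward closed. -/
def IsRLFilter {A : Type*} [ResiduatedLattice A] (F : Set A) : Prop :=
  F.Nonempty ∧ (∀ a ∈ F, ∀ b ∈ F, mul a b ∈ F) ∧ ∀ a ∈ F, ∀ b : A, a ≤ b → b ∈ F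

/-- The principal filter of a residuated lattice generated by `a`:
`{b | aⁿ ≤ b for some n ≥ 1}`. -/
def rprinc {A : Type*} [ResiduatedLattice A] (a : A) : Set A :=
  {b | ∃ n : ℕ, 1 ≤ n ∧ rpow a n ≤ b}

/-- A reticulation of a residuated lattice `A`: a surjection `lam` onto a bounded
distributive lattice satisfying the five defining conditions. -/
structure IsReticulation {A L : Type*} [ResiduatedLattice A] [DistribLattice L]
    [BoundedOrder L] (lam : A → L) : Prop where
  map_mul : ∀ a b : A, lam (mul a b) = lam a ⊓ lam b
  map_sup : ∀ a b : A, lam (a ⊔ b) = lam a ⊔ lam b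
  map_bot : lam ⊥ = ⊥
  map_top : lam ⊤ = ⊤
  surj : Function.Surjective lam
  le_iff : ∀ a b : A, lam a ≤ lam b ↔ ∃ n : ℕ, 1 ≤ n ∧ rpow a n ≤ b

/-- The co-annihilator of a subset `X`: `{a | a ⊔ x = ⊤ for all x ∈ X}`. -/
def coann {A : Type*} [Lattice A] [BoundedOrder A] (X : Set A) : Set A :=
  {a | ∀ x ∈ X, a ⊔ x = ⊤}

/-- The Boolean center: the set of complemented elements. -/
def BCenter (A : Type*) [Lattice A] [BoundedOrder A] : Set A :=
  {e | ∃ f : A, e ⊓ f = ⊥ ∧ e ⊔ f = ⊤}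

/-- A strongly Stone residuated lattice: the co-annihilator of every subset is a
principal filter generated by a complemented element. -/
def IsStronglyStoneRL (A : Type*) [ResiduatedLattice A] : Prop :=
  ∀ X : Set A, ∃ e ∈ BCenter A, coann X = rprinc e

/-- A strongly Stone bounded distributive lattice: the co-annihilator of every subset
is a principal filter generated by a complemented element. -/
def IsStronglyStoneLat (L : Type*) [Lattice L] [BoundedOrder L] : Prop :=
  ∀ X : Set L, ∃ e ∈ BCenter L, coann X = Set.Ici e

section Helpers

variable {A : Type*} [ResiduatedLattice A]

theorem rl_mul_mono_left {a b : A} (c : A) (hab : a ≤ b) : mul a c ≤ mul b c :=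
  (residuation a c _).1 (hab.trans ((residuation b c _).2 le_rfl))

theorem rl_mul_mono {a b c d : A} (hab : a ≤ b) (hcd : c ≤ d) : mul a c ≤ mul b d := by
  refine (rl_mul_mono_left c hab).trans ?_
  rw [ResiduatedLattice.mul_comm b c, ResiduatedLattice.mul_comm b d]
  exact rl_mul_mono_left b hcd

theorem rl_mul_le_left (a b : A) : mul a b ≤ a := by
  have := rl_mul_mono (le_refl a) (le_top : b ≤ ⊤)
  rwa [mul_top] at this

theorem rl_mul_le_right (a b : A) : mul a b ≤ b := by
  rw [ResiduatedLattice.mul_comm]; exact rl_mul_le_left b a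

theorem rl_inf_le_mul {e f : A} (hef : e ⊔ f = ⊤) : e ⊓ f ≤ mul e f := by
  have h1 : e ≤ himp (e ⊓ f) (mul e f) :=
    (residuation _ _ _).2 (rl_mul_mono le_rfl inf_le_right)
  have h2 : f ≤ himp (e ⊓ f) (mul e f) := by
    rw [residuation, ResiduatedLattice.mul_comm]
    exact rl_mul_mono inf_le_left le_rfl
  have h3 : (⊤ : A) ≤ himp (e ⊓ f) (mul e f) := hef ▸ sup_le h1 h2
  rw [residuation, ResiduatedLattice.mul_comm, mul_top] at h3
  exact h3

theorem rl_rpow_top (n : ℕ) : rpow (⊤ : A) n = ⊤ := by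
  induction n with
  | zero => rfl
  | succ n ih => rw [rpow, ih, mul_top]

theorem rl_rpow_mul (a b : A) (n : ℕ) : rpow (mul a b) n = mul (rpow a n) (rpow b n) := by
  induction n with
  | zero => simp only [rpow, mul_top]
  | succ n ih =>
    simp only [rpow, ih]
    rw [ResiduatedLattice.mul_assoc, ResiduatedLattice.mul_assoc,
      ← ResiduatedLattice.mul_assoc b, ← ResiduatedLattice.mul_assoc (rpow a n),
      ResiduatedLattice.mul_comm b]

variable {L : Type*} [DistribLattice L] [BoundedOrder L] {lam : A → L}

theorem ret_eq_top (h : IsReticulation lam) (a : A) : lam a = ⊤ ↔ a = ⊤ := by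
  constructor
  · intro ha
    obtain ⟨n, -, hn⟩ := (h.le_iff ⊤ a).1 (by rw [ha]; exact le_top)
    rw [rl_rpow_top] at hn
    exact top_le_iff.1 hn
  · rintro rfl; exact h.map_top

theorem ret_rpow (h : IsReticulation lam) (a : A) (n : ℕ) (hn : 1 ≤ n) :
    lam (rpow a n) = lam a := by
  induction n, hn using Nat.le_induction with
  | base => simp only [rpow, mul_top]
  | succ n _ ih => rw [rpow, h.map_mul, ih, inf_idem]

theorem ret_mem_coann (h : IsReticulation lam) (X : Set A) (a : A) :
    a ∈ coann X ↔ lam a ∈ coann (lam '' X) := by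
  simp only [coann, Set.mem_setOf_eq, Set.forall_mem_image, ← h.map_sup, ret_eq_top h]

theorem ret_mem_rprinc (h : IsReticulation lam) (e a : A) :
    a ∈ rprinc e ↔ lam a ∈ Set.Ici (lam e) :=
  (h.le_iff e a).symm

end Helpers

/-- `A` is a strongly Stone residuated lattice iff its reticulation `L`
is a strongly Stone lattice. -/
theorem stmt_11 {A L : Type*} [ResiduatedLattice A] [DistribLattice L] [BoundedOrder L]
    (lam : A → L) (h : IsReticulation lam) :
    IsStronglyStoneRL A ↔ IsStronglyStoneLat L := by
  constructor
  · intro hA Y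
    obtain ⟨e, ⟨f, hf1, hf2⟩, he⟩ := hA (lam ⁻¹' Y)
    refine ⟨lam e, ⟨lam f, ?_, ?_⟩, ?_⟩
    · rw [← h.map_mul, ← h.map_bot]
      congr 1
      exact le_bot_iff.1 (hf1 ▸ le_inf (rl_mul_le_left e f) (rl_mul_le_right e f))
    · rw [← h.map_sup, hf2, h.map_top]
    · ext y
      obtain ⟨a, rfl⟩ := h.surj y
      rw [← ret_mem_rprinc h, ← he, ret_mem_coann h, Set.image_preimage_eq _ h.surj]
  · intro hL X
    obtain ⟨e', ⟨f', h1, h2⟩, he⟩ := hL (lam '' X)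
    obtain ⟨e, rfl⟩ := h.surj e'
    obtain ⟨f, rfl⟩ := h.surj f'
    obtain ⟨n, hn, hle⟩ := (h.le_iff (mul e f) ⊥).1 (by rw [h.map_mul, h1]; exact bot_le)
    have htop : rpow e n ⊔ rpow f n = ⊤ := by
      rw [← ret_eq_top h, h.map_sup, ret_rpow h _ _ hn, ret_rpow h _ _ hn, h2]
    refine ⟨rpow e n, ⟨rpow f n, ?_, htop⟩, ?_⟩
    · rw [rl_rpow_mul] at hle
      exact le_bot_iff.1 ((rl_inf_le_mul htop).trans hle)
    · ext a
      rw [ret_mem_coann h, he, ret_mem_rprinc h, ret_rpow h _ _ hn]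
end

section
/- Let A be a residuated lattice and (L, λ) a reticulation of A. The map μ : Co-Ann(A) → Co-Ann(L) defined by μ(F) = λ(F) is an isomorphism of Boolean algebras, where Co-Ann(A) = {X^⊤ | X ⊆ A} is equipped with meet F ∩ G, join F ∨^⊤ G = (F^⊤ ∩ G^⊤)^⊤, complementation F ↦ F^⊤, least element {1} and greatest element A (and similarly for Co-Ann(L)). -/
open ResiduatedLattice

/-- The collection `Co-Ann(A)` of all co-annihilators of subsets of `A`. -/
def CoAnnSet (A : Type*) [Lattice A] [BoundedOrder A] : Set (Set A) :=
  {F | ∃ X : Set A, F = coann X}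

theorem rpow_top_aux {A : Type*} [ResiduatedLattice A] (n : ℕ) : rpow (⊤ : A) n = ⊤ := by
  induction n with
  | zero => rfl
  | succ k ih => simp only [rpow]; rw [ih, ResiduatedLattice.mul_top]

theorem lam_top_aux {A L : Type*} [ResiduatedLattice A] [DistribLattice L] [BoundedOrder L]
    {lam : A → L} (h : IsReticulation lam) (a : A) : lam a = ⊤ ↔ a = ⊤ := by
  constructor
  · intro ha
    have h1 : lam ⊤ ≤ lam a := by rw [ha]; exact le_top
    obtain ⟨n, _, hn⟩ := (h.le_iff _ _).1 h1
    rw [rpow_top_aux] at hn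
    exact top_le_iff.1 hn
  · rintro rfl
    exact h.map_top

theorem coann_pre_aux {A L : Type*} [ResiduatedLattice A] [DistribLattice L] [BoundedOrder L]
    {lam : A → L} (h : IsReticulation lam) (X : Set A) :
    coann X = lam ⁻¹' coann (lam '' X) := by
  ext a
  simp only [coann, Set.mem_preimage, Set.mem_setOf_eq, Set.forall_mem_image, ← h.map_sup,
    lam_top_aux h]

theorem coann_image_aux {A L : Type*} [ResiduatedLattice A] [DistribLattice L] [BoundedOrder L]
    {lam : A → L} (h : IsReticulation lam) (X : Set A) :
    lam '' coann X = coann (lam '' X) := by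
  rw [coann_pre_aux h, Set.image_preimage_eq _ h.surj]

/-- for a reticulation `(L, lam)` of a residuated lattice `A`, the map
`μ : Co-Ann(A) → Co-Ann(L)`, `μ(F) = lam '' F`, is an isomorphism of Boolean algebras:
it is a well-defined bijection which preserves meet (`∩`), join
(`F ∨^⊤ G = (F^⊤ ∩ G^⊤)^⊤`), complementation (`F ↦ F^⊤`), the least element `{1}`
and the greatest element `A`. -/
theorem stmt_12 {A L : Type*} [ResiduatedLattice A] [DistribLattice L] [BoundedOrder L]
    (lam : A → L) (h : IsReticulation lam) :
    -- well defined
    (∀ F ∈ CoAnnSet A, lam '' F ∈ CoAnnSet L) ∧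
    -- injective
    (∀ F ∈ CoAnnSet A, ∀ G ∈ CoAnnSet A, lam '' F = lam '' G → F = G) ∧
    -- surjective
    (∀ G ∈ CoAnnSet L, ∃ F ∈ CoAnnSet A, lam '' F = G) ∧
    -- preserves meet
    (∀ F ∈ CoAnnSet A, ∀ G ∈ CoAnnSet A, lam '' (F ∩ G) = (lam '' F) ∩ (lam '' G)) ∧
    -- preserves join `F ∨^⊤ G = (F^⊤ ∩ G^⊤)^⊤`
    (∀ F ∈ CoAnnSet A, ∀ G ∈ CoAnnSet A,
      lam '' coann (coann F ∩ coann G) = coann (coann (lam '' F) ∩ coann (lam '' G))) ∧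
    -- preserves complementation
    (∀ F ∈ CoAnnSet A, lam '' coann F = coann (lam '' F)) ∧
    -- preserves the least element {1} and the greatest element A
    (lam '' ({⊤} : Set A) = ({⊤} : Set L) ∧ lam '' (Set.univ : Set A) = Set.univ) := by
  have meet : ∀ F ∈ CoAnnSet A, ∀ G ∈ CoAnnSet A,
      lam '' (F ∩ G) = (lam '' F) ∩ (lam '' G) := by
    rintro _ ⟨X, rfl⟩ _ ⟨Y, rfl⟩
    rw [coann_pre_aux h X, coann_pre_aux h Y, ← Set.preimage_inter,
      Set.image_preimage_eq _ h.surj, Set.image_preimage_eq _ h.surj,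
      Set.image_preimage_eq _ h.surj]
  refine ⟨?_, ?_, ?_, meet, ?_, fun F _ => coann_image_aux h F, ?_, ?_⟩
  · rintro _ ⟨X, rfl⟩
    exact ⟨_, coann_image_aux h X⟩
  · rintro _ ⟨X, rfl⟩ _ ⟨Y, rfl⟩ e
    rw [coann_image_aux h, coann_image_aux h] at e
    rw [coann_pre_aux h X, coann_pre_aux h Y, e]
  · rintro _ ⟨Y, rfl⟩
    refine ⟨_, ⟨lam ⁻¹' Y, rfl⟩, ?_⟩
    rw [coann_image_aux h, Set.image_preimage_eq _ h.surj]
  · intro F _ G _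
    rw [coann_image_aux h, meet _ ⟨F, rfl⟩ _ ⟨G, rfl⟩, coann_image_aux h, coann_image_aux h]
  · rw [Set.image_singleton, h.map_top]
  · rw [Set.image_univ, h.surj.range_eq]
end
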